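/- Let K be a field of characteristic ≠ 2 with more than three elements, G = SL₂(K), and V a quadratic ℤ[G]-module. Let U⁻ = {u⁻_λ = (1 0; λ 1) : λ ∈ K} and w = (0 1; −1 0). Then: (i) [G,V] = [U,V] ⊕ [U⁻,V]; (ii) [U,V] equals the set of fixed points of U inside [G,V] (in particular every u_λ fixes [U,V] pointwise); (iii) w·[U,V] = [U⁻,V] and w·[U⁻,V] = [U,V]; (iv) w²·v = −v for every v ∈ [G,V], while w fixes C_V(G) pointwise. -/

import Mathlib

/-!
STATEMENT 5: Let K be a field of characteristic ≠ 2 with more than three elements,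
G = SL₂(K), and V a quadratic ℤ[G]-module.  With U⁻ the lower unitriangular subgroup and
w = (0 1; −1 0):
(i) [G,V] = [U,V] ⊕ [U⁻,V];
(ii) [U,V] equals the set of fixed points of U inside [G,V];
(iii) w·[U,V] = [U⁻,V] and w·[U⁻,V] = [U,V];
(iv) w²·v = −v for every v ∈ [G,V], while w fixes C_V(G) pointwise.
-/

noncomputable section

abbrev SL2 (K : Type*) [Field K] := Matrix.SpecialLinearGroup (Fin 2) K

/-- `u_λ = (1 λ; 0 1)`. -/
def uEl {K : Type*} [Field K] (lam : K) : SL2 K :=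
  ⟨!![1, lam; 0, 1], by simp [Matrix.det_fin_two_of]⟩

/-- `u⁻_λ = (1 0; λ 1)`. -/
def umEl {K : Type*} [Field K] (lam : K) : SL2 K :=
  ⟨!![1, 0; lam, 1], by simp [Matrix.det_fin_two_of]⟩

/-- `w = (0 1; −1 0)`. -/
def wEl (K : Type*) [Field K] : SL2 K :=
  ⟨!![0, 1; -1, 0], by simp [Matrix.det_fin_two_of]⟩

/-- The fixed points `C_V(S)` of a set `S` of group elements. -/
def fixV {K : Type*} (V : Type*) [Field K] [AddCommGroup V] [DistribMulAction (SL2 K) V]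
    (S : Set (SL2 K)) : AddSubgroup V where
  carrier := {v | ∀ g ∈ S, g • v = v}
  zero_mem' := by intro g _; simp
  add_mem' := by intro a b ha hb g hg; rw [smul_add, ha g hg, hb g hg]
  neg_mem' := by intro a ha g hg; rw [smul_neg, ha g hg]

/-- `[S,V]`, the subgroup of `V` generated by `{g·v − v : g ∈ S, v ∈ V}`. -/
def commV {K : Type*} (V : Type*) [Field K] [AddCommGroup V] [DistribMulAction (SL2 K) V]
    (S : Set (SL2 K)) : AddSubgroup V :=
  AddSubgroup.closure {w | ∃ g ∈ S, ∃ v : V, w = g • v - v}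

theorem ring_aux {R : Type*} [Ring R] (x y : R) (hx : x * x = 0) (hy : y * y = 0)
    (hb : (1 + x) * (1 - y) * (1 + x) = (1 - y) * (1 + x) * (1 - y)) :
    ((1 + x) * (1 - y) * (1 + x)) * ((1 + x) * (1 - y) * (1 + x))
      = 1 + 6 * (x - x * y * x) - 2 * (x * y + y * x) ∧
    x * y * x + y * x * y = x + y ∧ x * y * x * y = x * y ∧ y * x * y * x = y * x := by
  have h : y * (x * y) = x + y - x * (y * x) := by
    have h1 : (1 + x) * (1 - y) * (1 + x) = 1 + 2 * x - y - x * y - y * x - x * (y * x) + x * x - x * (y * x) + x * (y * x) := by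
      noncomm_ring
    have h2 : (1 - y) * (1 + x) * (1 - y) = 1 + x - 2 * y - x * y - y * x + y * (x * y) + y * y := by
      noncomm_ring
    rw [h1, h2, hx, hy] at hb
    have := sub_eq_zero.2 hb
    rw [← sub_eq_zero, ← neg_eq_zero, ← this]
    noncomm_ring
  have hx' : ∀ a, x * (x * a) = 0 := fun a => by rw [← mul_assoc, hx, zero_mul]
  have hy' : ∀ a, y * (y * a) = 0 := fun a => by rw [← mul_assoc, hy, zero_mul]
  have h3 : x * (y * (x * y)) = x * y := by
    rw [h]; simp [mul_sub, mul_add, hx, hx']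
  have h4 : y * (x * (y * x)) = y * x := by
    have := congrArg (fun a => y * a) h
    simp only [mul_sub, mul_add, hy, hy'] at this
    rw [add_zero] at this
    exact (sub_eq_zero.1 this.symm).symm
  refine ⟨?_, ?_, ?_, ?_⟩
  · have h1 : (1 + x) * (1 - y) * (1 + x) = 1 + 2 • x - y - x * y - y * x - x * (y * x) := by
      have : (1 + x) * (1 - y) * (1 + x) = 1 + 2 • x - y - x * y - y * x - x * (y * x) + x * x := by
        noncomm_ring
      rw [this, hx, add_zero]
    rw [h1]
    have e6 : (6 : R) * (x - x * y * x) = 6 • (x - x * (y * x)) := by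
      rw [mul_assoc, nsmul_eq_mul]; norm_num
    have e2 : (2 : R) * (x * y + y * x) = 2 • (x * y + y * x) := by
      rw [nsmul_eq_mul]; norm_num
    rw [e6, e2]
    simp only [mul_sub, mul_add, sub_mul, add_mul, mul_one, one_mul, mul_assoc, hx, hy, hx', hy',
      h3, h4, h, smul_mul_assoc, mul_smul_comm, mul_zero, smul_zero]
    abel
  · rw [mul_assoc, mul_assoc y, h]; abel
  · simpa [mul_assoc] using h3
  · simpa [mul_assoc] using h4

section grp
variable {K : Type*} [Field K]

theorem SL2_ext {A B : SL2 K} (h : (A : Matrix (Fin 2) (Fin 2) K) = B) : A = B := Subtype.ext h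

theorem u_coe (a : K) : (uEl a : Matrix (Fin 2) (Fin 2) K) = !![1, a; 0, 1] := rfl

theorem um_coe (a : K) : (umEl a : Matrix (Fin 2) (Fin 2) K) = !![1, 0; a, 1] := rfl

theorem w_coe : (wEl K : Matrix (Fin 2) (Fin 2) K) = !![0, 1; -1, 0] := rfl

theorem u_add (a b : K) : uEl (a + b) = uEl a * uEl b := by
  apply SL2_ext; simp [u_coe, Matrix.mul_fin_two, add_comm]

theorem um_add (a b : K) : umEl (a + b) = umEl a * umEl b := by
  apply SL2_ext; simp [um_coe, Matrix.mul_fin_two]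

theorem u_zero : uEl (0 : K) = 1 := by
  apply SL2_ext; simp [u_coe, Matrix.one_fin_two]

theorem um_zero : umEl (0 : K) = 1 := by
  apply SL2_ext; simp [um_coe, Matrix.one_fin_two]

theorem w_u (a : K) : wEl K * uEl a = umEl (-a) * wEl K := by
  apply SL2_ext; simp [u_coe, um_coe, w_coe, Matrix.mul_fin_two]

theorem w_um (a : K) : wEl K * umEl a = uEl (-a) * wEl K := by
  apply SL2_ext; simp [u_coe, um_coe, w_coe, Matrix.mul_fin_two]

theorem w_eq : wEl K = uEl 1 * umEl (-1) * uEl 1 := by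
  apply SL2_ext; simp [u_coe, um_coe, w_coe, Matrix.mul_fin_two]

theorem braid (a : K) (ha : a ≠ 0) :
    uEl a * umEl (-a⁻¹) * uEl a = umEl (-a⁻¹) * uEl a * umEl (-a⁻¹) := by
  apply SL2_ext; simp [u_coe, um_coe, Matrix.mul_fin_two, ha]

theorem w_sq (a : K) (ha : a ≠ 0) :
    (uEl a * umEl (-a⁻¹) * uEl a) * (uEl a * umEl (-a⁻¹) * uEl a) = wEl K * wEl K := by
  apply SL2_ext; simp [u_coe, um_coe, w_coe, Matrix.mul_fin_two, ha]

theorem z_comm (g : SL2 K) : wEl K * wEl K * g = g * (wEl K * wEl K) := by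
  have : ((wEl K * wEl K : SL2 K) : Matrix (Fin 2) (Fin 2) K) = -1 := by
    simp [w_coe, Matrix.mul_fin_two, Matrix.one_fin_two]
  apply SL2_ext
  rw [Matrix.SpecialLinearGroup.coe_mul _ g, Matrix.SpecialLinearGroup.coe_mul g, this]
  simp

def hEl (t : K) (ht : t ≠ 0) : SL2 K := ⟨!![t, 0; 0, t⁻¹], by simp [Matrix.det_fin_two_of, ht]⟩

theorem h_coe (t : K) (ht : t ≠ 0) : (hEl t ht : Matrix (Fin 2) (Fin 2) K) = !![t, 0; 0, t⁻¹] := rfl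

theorem h_u (t : K) (ht : t ≠ 0) (a : K) : hEl t ht * uEl a = uEl (t * t * a) * hEl t ht := by
  apply SL2_ext; simp [u_coe, h_coe, Matrix.mul_fin_two]; field_simp

theorem gen_ind {P : SL2 K → Prop} (hu : ∀ a, P (uEl a)) (hm : ∀ a, P (umEl a))
    (hmul : ∀ g h, P g → P h → P (g * h)) (g : SL2 K) : P g := by
  have key : ∀ g : SL2 K, g.1 1 0 ≠ 0 → P g := by
    intro g hg
    have hd := g.2
    rw [Matrix.det_fin_two] at hd
    have : g = uEl ((g.1 0 0 - 1) / g.1 1 0) * umEl (g.1 1 0) * uEl ((g.1 1 1 - 1) / g.1 1 0) := by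
      apply SL2_ext
      rw [Matrix.eta_fin_two (g : Matrix (Fin 2) (Fin 2) K)]
      simp only [Matrix.SpecialLinearGroup.coe_mul, u_coe, um_coe, Matrix.mul_fin_two]
      ext i j
      fin_cases i <;> fin_cases j <;> simp <;> field_simp <;> grind
    rw [this]
    exact hmul _ _ (hmul _ _ (hu _) (hm _)) (hu _)
  by_cases hg : g.1 1 0 = 0
  · have hd := g.2
    rw [Matrix.det_fin_two, hg] at hd
    have h1 : P (g * umEl 1) := by
      apply key
      have : (g * umEl 1).1 1 0 = g.1 1 1 := by
        simp [um_coe, Matrix.mul_apply, Fin.sum_univ_two, hg]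
      rw [this]
      rintro h
      simp [h] at hd
    have : g = (g * umEl 1) * umEl (-1) := by
      rw [mul_assoc, ← um_add]; simp [um_zero]
    rw [this]
    exact hmul _ _ h1 (hm _)
  · exact key g hg
end grp

theorem main_aux {K R : Type*} [Field K] [Ring R] (h2 : (2 : K) ≠ 0)
    (ht : ∃ t : K, t ≠ 0 ∧ t * t ≠ 1) (ρ : SL2 K →* R)
    (hq : ∀ a b : K, (ρ (uEl a) - 1) * (ρ (uEl b) - 1) = 0) :
    (∀ a b : K, (ρ (umEl a) - 1) * (ρ (umEl b) - 1) = 0) ∧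
    (∀ a, ρ (wEl K * wEl K) * (ρ (uEl a) - 1) = -(ρ (uEl a) - 1)) ∧
    (∀ a, ρ (wEl K * wEl K) * (ρ (umEl a) - 1) = -(ρ (umEl a) - 1)) ∧
    ∃ p q : R,
      (∀ a, (p * (ρ (uEl 1) - 1) + q * (ρ (umEl 1) - 1)) * (ρ (uEl a) - 1) = ρ (uEl a) - 1) ∧
      (∀ a, (p * (ρ (uEl 1) - 1) + q * (ρ (umEl 1) - 1)) * (ρ (umEl a) - 1) = ρ (umEl a) - 1) := by
  obtain ⟨X, hX⟩ : ∃ X : K → R, ∀ a, X a = ρ (uEl a) - 1 := ⟨_, fun _ => rfl⟩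
  obtain ⟨Y, hY⟩ : ∃ Y : K → R, ∀ a, Y a = ρ (umEl a) - 1 := ⟨_, fun _ => rfl⟩
  have hX' : ∀ a, ρ (uEl a) = 1 + X a := fun a => by rw [hX]; abel
  have hY' : ∀ a, ρ (umEl a) = 1 + Y a := fun a => by rw [hY]; abel
  simp only [← hX, ← hY] at hq ⊢
  have hWW : ρ (wEl K) * ρ (wEl K)⁻¹ = 1 := by rw [← map_mul]; simp
  have hWW' : ρ (wEl K)⁻¹ * ρ (wEl K) = 1 := by rw [← map_mul]; simp
  have hYX : ∀ a, Y a = ρ (wEl K) * X (-a) * ρ (wEl K)⁻¹ := by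
    intro a
    rw [hX, hY, mul_sub, sub_mul, mul_one, hWW, ← map_mul, w_u, ← map_mul]
    simp
  have hqY : ∀ a b, Y a * Y b = 0 := by
    intro a b
    rw [hYX, hYX]
    calc _ = ρ (wEl K) * X (-a) * (ρ (wEl K)⁻¹ * ρ (wEl K)) * X (-b) * ρ (wEl K)⁻¹ := by
          simp only [mul_assoc]
      _ = 0 := by rw [hWW', mul_one, mul_assoc (ρ (wEl K)), hq]; simp
  have hXadd : ∀ a b, X (a + b) = X a + X b := by
    intro a b
    have := hX (a + b)
    rw [u_add, map_mul, hX', hX'] at this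
    rw [this]
    simp only [mul_add, add_mul, hq, mul_one, one_mul]; abel
  have hYadd : ∀ a b, Y (a + b) = Y a + Y b := by
    intro a b
    have := hY (a + b)
    rw [um_add, map_mul, hY', hY'] at this
    rw [this]
    simp only [mul_add, add_mul, hqY, mul_one, one_mul]; abel
  have hX0 : X 0 = 0 := by rw [hX, u_zero]; simp
  have hY0 : Y 0 = 0 := by rw [hY, um_zero]; simp
  have hYneg : ∀ a, Y (-a) = - Y a := by
    intro a
    have := hYadd (-a) a
    rw [neg_add_cancel, hY0] at this
    exact eq_neg_of_add_eq_zero_left this.symm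
  obtain ⟨z, hz⟩ : ∃ z, z = ρ (wEl K * wEl K) := ⟨_, rfl⟩
  rw [← hz]
  have hzc : ∀ g, z * ρ g = ρ g * z := by
    intro g; rw [hz, ← map_mul, z_comm, map_mul]
  have hzX : ∀ a, z * X a = X a * z := by
    intro a; rw [hX, mul_sub, hzc, sub_mul]; simp
  have hzY : ∀ a, z * Y a = Y a * z := by
    intro a; rw [hY, mul_sub, hzc, sub_mul]; simp
  have ring1 : ∀ a : K, a ≠ 0 →
      z = 1 + 6 * (X a - X a * Y a⁻¹ * X a) - 2 * (X a * Y a⁻¹ + Y a⁻¹ * X a) ∧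
      X a * Y a⁻¹ * X a + Y a⁻¹ * X a * Y a⁻¹ = X a + Y a⁻¹ ∧
      X a * Y a⁻¹ * X a * Y a⁻¹ = X a * Y a⁻¹ ∧ Y a⁻¹ * X a * Y a⁻¹ * X a = Y a⁻¹ * X a := by
    intro a ha
    have hb := congrArg ρ (braid a ha)
    have hs := congrArg ρ (w_sq a ha)
    rw [← hz] at hs
    simp only [map_mul, hX', hY', hYneg, ← sub_eq_add_neg] at hb hs
    have := ring_aux (X a) (Y a⁻¹) (hq _ _) (hqY _ _) hb
    rw [hs] at this
    exact this
  have zX : ∀ a : K, a ≠ 0 → (1 + z) * X a = 2 * (X a - X a * Y a⁻¹ * X a) := by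
    intro a ha
    obtain ⟨r1, r2, r3, r4⟩ := ring1 a ha
    have e : (X a - X a * Y a⁻¹ * X a) * X a = 0 := by
      rw [sub_mul, mul_assoc _ (X a), hq]; simp
    have e2 : (X a * Y a⁻¹ + Y a⁻¹ * X a) * X a = X a * Y a⁻¹ * X a := by
      rw [add_mul, mul_assoc (Y _), hq]; simp
    rw [r1, add_mul, sub_mul, add_mul, mul_assoc 6, e, mul_assoc 2, e2]
    noncomm_ring
  have zY : ∀ a : K, a ≠ 0 → (1 + z) * Y a⁻¹ = - (2 * (X a - X a * Y a⁻¹ * X a)) := by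
    intro a ha
    obtain ⟨r1, r2, r3, r4⟩ := ring1 a ha
    have e : (X a - X a * Y a⁻¹ * X a) * Y a⁻¹ = 0 := by
      rw [sub_mul, r3]; simp
    have e2 : (X a * Y a⁻¹ + Y a⁻¹ * X a) * Y a⁻¹ = X a + Y a⁻¹ - X a * Y a⁻¹ * X a := by
      rw [add_mul, mul_assoc (X a), hqY, ← r2]; simp
    rw [r1, add_mul, sub_mul, add_mul, mul_assoc 6, e, mul_assoc 2, e2]
    noncomm_ring
  have fXY : ∀ a : K, a ≠ 0 → (1 + z) * X a = - ((1 + z) * Y a⁻¹) := by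
    intro a ha; rw [zX a ha, zY a ha, neg_neg]
  have cX : ∀ a, (1 + z) * X a = X a * (1 + z) := by
    intro a; rw [add_mul, mul_add, hzX]; simp
  have cY : ∀ a, (1 + z) * Y a = Y a * (1 + z) := by
    intro a; rw [add_mul, mul_add, hzY]; simp
  have fr : ∀ a : K, a ≠ 0 → ∀ g, (1 + z) * X a * ρ g = (1 + z) * X a := by
    intro a ha g
    induction g using gen_ind with
    | hu b => rw [hX', mul_add, mul_one, mul_assoc _ (X a), hq]; simp
    | hm b => rw [hY', mul_add, mul_one, fXY a ha, neg_mul, mul_assoc _ (Y _), hqY]; simp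
    | hmul g h hg hh => rw [map_mul, ← mul_assoc, hg, hh]
  have fl : ∀ a : K, a ≠ 0 → ∀ g, ρ g * ((1 + z) * X a) = (1 + z) * X a := by
    intro a ha g
    induction g using gen_ind with
    | hu b => rw [hX', add_mul, cX a, ← mul_assoc (X b), hq]; simp
    | hm b => rw [hY', add_mul, one_mul, fXY a ha, cY, mul_neg, ← mul_assoc (Y b), hqY]; simp
    | hmul g h hg hh => rw [map_mul, mul_assoc, hh, hg]
  have fz : ∀ a, (1 + z) * X a = 0 := by
    obtain ⟨t, t0, t1⟩ := ht
    have key : ∀ a, a ≠ 0 → (1 + z) * X (t * t * a) = (1 + z) * X a := by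
      intro a ha
      have hta : t * t * a ≠ 0 := mul_ne_zero (mul_ne_zero t0 t0) ha
      have e : ρ (hEl t t0) * X a = X (t * t * a) * ρ (hEl t t0) := by
        rw [hX, hX, mul_sub, sub_mul, ← map_mul, h_u, map_mul]; simp
      rw [← fr _ hta (hEl t t0), mul_assoc, ← e, ← mul_assoc, add_mul, hzc, one_mul]
      rw [← fl a ha (hEl t t0)]
      noncomm_ring
    intro a
    by_cases ha : a = 0
    · rw [ha, hX0, mul_zero]
    have t2 : t * t - 1 ≠ 0 := sub_ne_zero.2 t1
    have k := key (a / (t * t - 1)) (div_ne_zero ha t2)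
    have : t * t * (a / (t * t - 1)) = a + a / (t * t - 1) := by
      rw [eq_comm, ← mul_div_assoc, eq_div_iff t2, add_mul, div_mul_cancel₀ _ t2]; ring
    rw [this, hXadd, mul_add] at k
    simpa using k
  have fzY : ∀ a, (1 + z) * Y a = 0 := by
    intro a
    by_cases ha : a = 0
    · rw [ha, hY0, mul_zero]
    have := fXY a⁻¹ (inv_ne_zero ha)
    rw [fz, inv_inv] at this
    exact neg_eq_zero.1 this.symm
  have hhalf : ∀ a : K, a = a / 2 + a / 2 := by intro a; field_simp; ring
  have d1 : ∀ a : K, X a * Y a⁻¹ * X a = X a := by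
    intro a
    by_cases ha : a = 0
    · simp [ha, hX0]
    obtain ⟨b, hb⟩ : ∃ b, b = a / 2 := ⟨_, rfl⟩
    have hab : a = b + b := by rw [hb]; exact hhalf a
    have hb0 : b ≠ 0 := by rw [hb]; exact div_ne_zero ha h2
    have hinv : b⁻¹ = a⁻¹ + a⁻¹ := by rw [hb]; field_simp; ring
    have k := zX b hb0
    rw [fz, hinv, hYadd] at k
    have hXa : X a = X b + X b := by rw [hab, hXadd]
    rw [hXa]
    have k2 : X b * (Y a⁻¹ + Y a⁻¹) * X b * 2 = X b * 2 := by
      have := sub_eq_zero.1 ((mul_sub _ _ _).symm.trans k.symm)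
      rw [mul_two, mul_two, ← two_mul, ← two_mul (X b), this]
    calc _ = X b * (Y a⁻¹ + Y a⁻¹) * X b * 2 := by noncomm_ring
      _ = _ := by rw [k2, mul_two]
  obtain ⟨r1, r2, r3, r4⟩ := ring1 1 one_ne_zero
  have hd := d1 1
  rw [hd] at r1
  simp only [inv_one] at r1
  obtain ⟨e, he⟩ : ∃ e, e = X 1 * Y 1 + Y 1 * X 1 := ⟨_, rfl⟩
  rw [← he, sub_self, mul_zero, add_zero] at r1
  have eX : ∀ a, e * X a = X a := by
    intro a
    have k := fz (a / 2)
    rw [r1] at k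
    have hXa : X a = X (a / 2) + X (a / 2) := by rw [← hXadd, ← hhalf]
    rw [hXa, ← sub_eq_zero, ← neg_eq_zero, ← k]
    noncomm_ring
  have eY : ∀ a, e * Y a = Y a := by
    intro a
    have k := fzY (a / 2)
    rw [r1] at k
    have hYa : Y a = Y (a / 2) + Y (a / 2) := by rw [← hYadd, ← hhalf]
    rw [hYa, ← sub_eq_zero, ← neg_eq_zero, ← k]
    noncomm_ring
  have he' : Y 1 * X 1 + X 1 * Y 1 = e := by rw [he, add_comm]
  refine ⟨hqY, ?_, ?_, Y 1, X 1, ?_, ?_⟩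
  · intro a
    have := fz a
    rw [add_mul, one_mul, add_comm] at this
    exact eq_neg_of_add_eq_zero_left this
  · intro a
    have := fzY a
    rw [add_mul, one_mul, add_comm] at this
    exact eq_neg_of_add_eq_zero_left this
  · rw [he']; exact eX
  · rw [he']; exact eY

theorem exists_t {K : Type*} [Field K] (hcard : 3 < Cardinal.mk K) :
    ∃ t : K, t ≠ 0 ∧ t * t ≠ 1 := by
  classical
  by_contra! h
  have : (Set.univ : Set K) ⊆ (({0, 1, -1} : Finset K) : Set K) := by
    intro t _
    by_cases h0 : t = 0
    · simp [h0]
    · have := mul_self_eq_one_iff.1 (h t h0)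
      simp; tauto
  have h1 := Cardinal.mk_le_mk_of_subset this
  rw [Cardinal.mk_univ] at h1
  have h1' := h1.trans_eq (Cardinal.mk_coe_finset (s := ({0, 1, -1} : Finset K)))
  have h2 : ({0, 1, -1} : Finset K).card ≤ 3 := Finset.card_le_three
  have h3 : ((({0, 1, -1} : Finset K).card : ℕ) : Cardinal) ≤ 3 := by exact_mod_cast h2
  exact absurd (hcard.trans_le (h1'.trans h3)) (lt_irrefl _)

theorem commV_le {K V : Type*} [Field K] [AddCommGroup V] [DistribMulAction (SL2 K) V]
    {S : Set (SL2 K)} (P : AddSubgroup V) (h : ∀ g ∈ S, ∀ v : V, g • v - v ∈ P) :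
    commV V S ≤ P := by
  rw [commV, AddSubgroup.closure_le]
  rintro _ ⟨g, hg, v, rfl⟩
  exact h g hg v

theorem mem_commV {K V : Type*} [Field K] [AddCommGroup V] [DistribMulAction (SL2 K) V]
    {S : Set (SL2 K)} {g : SL2 K} (hg : g ∈ S) (v : V) : g • v - v ∈ commV V S :=
  AddSubgroup.subset_closure ⟨g, hg, v, rfl⟩

theorem stmt5 (K V : Type*) [Field K]
    (hchar : ringChar K ≠ 2) (hcard : 3 < Cardinal.mk K)
    [AddCommGroup V] [DistribMulAction (SL2 K) V]
    (hquad : ∀ (lam mu : K) (v : V), uEl lam • (uEl mu • v - v) = uEl mu • v - v)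
    (U Um : Set (SL2 K)) (hU : U = Set.range (uEl (K := K))) (hUm : Um = Set.range umEl) :
    -- (i)  [G,V] = [U,V] ⊕ [U⁻,V]
    (Disjoint (commV V U) (commV V Um) ∧
      commV V U ⊔ commV V Um = commV V (Set.univ : Set (SL2 K))) ∧
    -- (ii) [U,V] is the set of fixed points of U inside [G,V]
    (∀ v : V, v ∈ commV V U ↔
      (v ∈ commV V (Set.univ : Set (SL2 K)) ∧ ∀ lam : K, uEl lam • v = v)) ∧
    -- (iii) w·[U,V] = [U⁻,V] and w·[U⁻,V] = [U,V]
    ((wEl K • ·) '' (commV V U : Set V) = (commV V Um : Set V) ∧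
      (wEl K • ·) '' (commV V Um : Set V) = (commV V U : Set V)) ∧
    -- (iv) w² acts as −1 on [G,V] and w fixes C_V(G) pointwise
    ((∀ v ∈ commV V (Set.univ : Set (SL2 K)), wEl K • wEl K • v = -v) ∧
      ∀ v ∈ fixV V (Set.univ : Set (SL2 K)), wEl K • v = v) := by
  have h2 : (2 : K) ≠ 0 := Ring.two_ne_zero hchar
  obtain ⟨hq, zX, zY, p, q, eX, eY⟩ := main_aux h2 (exists_t hcard)
    (DistribMulAction.toAddMonoidEnd (SL2 K) V) (by
      intro a b
      ext v
      have := hquad a b v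
      change uEl a • (uEl b • v - v) - (uEl b • v - v) = 0
      rw [this, sub_self])
  have hq' : ∀ (a b : K) (v : V), umEl a • (umEl b • v - v) = umEl b • v - v := by
    intro a b v
    have := DFunLike.congr_fun (hq a b) v
    exact sub_eq_zero.1 this
  have zX' : ∀ (a : K) (v : V), wEl K • wEl K • (uEl a • v - v) = -(uEl a • v - v) := by
    intro a v
    have := DFunLike.congr_fun (zX a) v
    rw [← mul_smul]
    exact this
  have zY' : ∀ (a : K) (v : V), wEl K • wEl K • (umEl a • v - v) = -(umEl a • v - v) := by
    intro a v
    have := DFunLike.congr_fun (zY a) v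
    rw [← mul_smul]
    exact this
  have eX' : ∀ (a : K) (v : V), p (uEl (1 : K) • (uEl a • v - v) - (uEl a • v - v)) +
      q (umEl (1 : K) • (uEl a • v - v) - (uEl a • v - v)) = uEl a • v - v :=
    fun a v => DFunLike.congr_fun (eX a) v
  have eY' : ∀ (a : K) (v : V), p (uEl (1 : K) • (umEl a • v - v) - (umEl a • v - v)) +
      q (umEl (1 : K) • (umEl a • v - v) - (umEl a • v - v)) = umEl a • v - v :=
    fun a v => DFunLike.congr_fun (eY a) v
  subst hU hUm
  let E : V →+ V := p.comp (DistribSMul.toAddMonoidHom V (uEl (1 : K)) - AddMonoidHom.id V) +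
    q.comp (DistribSMul.toAddMonoidHom V (umEl (1 : K)) - AddMonoidHom.id V)
  have hE : ∀ v, E v = p (uEl (1 : K) • v - v) + q (umEl (1 : K) • v - v) := fun v => rfl
  have hE0 : ∀ v, uEl (1 : K) • v = v → umEl (1 : K) • v = v → E v = 0 := by
    intro v h1 h2
    rw [hE, h1, h2]; simp
  have EU : ∀ v ∈ commV V (Set.range (uEl (K := K))), E v = v := by
    intro v hv
    have : commV V (Set.range (uEl (K := K))) ≤ (E - AddMonoidHom.id V).ker := by
      apply commV_le
      rintro _ ⟨a, rfl⟩ v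
      rw [AddMonoidHom.mem_ker, AddMonoidHom.sub_apply, hE, eX' a v]
      simp
    have := this hv
    rw [AddMonoidHom.mem_ker, AddMonoidHom.sub_apply, sub_eq_zero] at this
    exact this
  have EUm : ∀ v ∈ commV V (Set.range (umEl (K := K))), E v = v := by
    intro v hv
    have : commV V (Set.range (umEl (K := K))) ≤ (E - AddMonoidHom.id V).ker := by
      apply commV_le
      rintro _ ⟨a, rfl⟩ v
      rw [AddMonoidHom.mem_ker, AddMonoidHom.sub_apply, hE, eY' a v]
      simp
    have := this hv
    rw [AddMonoidHom.mem_ker, AddMonoidHom.sub_apply, sub_eq_zero] at this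
    exact this
  have fU : ∀ v ∈ commV V (Set.range (uEl (K := K))), ∀ a : K, uEl a • v = v := by
    intro v hv a
    have : commV V (Set.range (uEl (K := K))) ≤ fixV V (Set.range (uEl (K := K))) := by
      apply commV_le
      rintro _ ⟨a, rfl⟩ v _ ⟨b, rfl⟩
      exact hquad b a v
    exact this hv _ ⟨a, rfl⟩
  have fUm : ∀ v ∈ commV V (Set.range (umEl (K := K))), ∀ a : K, umEl a • v = v := by
    intro v hv a
    have : commV V (Set.range (umEl (K := K))) ≤ fixV V (Set.range (umEl (K := K))) := by
      apply commV_le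
      rintro _ ⟨a, rfl⟩ v _ ⟨b, rfl⟩
      exact hq' b a v
    exact this hv _ ⟨a, rfl⟩
  have hsup : commV V (Set.range (uEl (K := K))) ⊔ commV V (Set.range (umEl (K := K))) =
      commV V (Set.univ : Set (SL2 K)) := by
    apply le_antisymm
    · apply sup_le <;> exact commV_le _ fun g _ v => mem_commV (Set.mem_univ g) v
    · apply commV_le
      rintro g -
      induction g using gen_ind with
      | hu b => exact fun v => AddSubgroup.mem_sup_left (mem_commV (Set.mem_range_self b) v)
      | hm b => exact fun v => AddSubgroup.mem_sup_right (mem_commV (Set.mem_range_self b) v)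
      | hmul g h hg hh =>
        intro v
        have := add_mem (hg (h • v)) (hh v)
        rw [mul_smul]
        simpa using this
  have wU : ∀ v ∈ commV V (Set.range (uEl (K := K))),
      wEl K • v ∈ commV V (Set.range (umEl (K := K))) := by
    have : commV V (Set.range (uEl (K := K))) ≤
        (commV V (Set.range (umEl (K := K)))).comap (DistribSMul.toAddMonoidHom V (wEl K)) := by
      apply commV_le
      rintro _ ⟨a, rfl⟩ v
      change wEl K • (uEl a • v - v) ∈ commV V (Set.range (umEl (K := K)))
      rw [smul_sub, ← mul_smul, w_u, mul_smul]
      exact mem_commV (Set.mem_range_self _) _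
    exact fun v hv => this hv
  have wUm : ∀ v ∈ commV V (Set.range (umEl (K := K))),
      wEl K • v ∈ commV V (Set.range (uEl (K := K))) := by
    have : commV V (Set.range (umEl (K := K))) ≤
        (commV V (Set.range (uEl (K := K)))).comap (DistribSMul.toAddMonoidHom V (wEl K)) := by
      apply commV_le
      rintro _ ⟨a, rfl⟩ v
      change wEl K • (umEl a • v - v) ∈ commV V (Set.range (uEl (K := K)))
      rw [smul_sub, ← mul_smul, w_um, mul_smul]
      exact mem_commV (Set.mem_range_self _) _
    exact fun v hv => this hv
  have hneg : ∀ v ∈ commV V (Set.univ : Set (SL2 K)), wEl K • wEl K • v = -v := by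
    let F : V →+ V := (DistribSMul.toAddMonoidHom V (wEl K)).comp
      (DistribSMul.toAddMonoidHom V (wEl K)) + AddMonoidHom.id V
    have hF : ∀ v, F v = wEl K • wEl K • v + v := fun v => rfl
    have : commV V (Set.univ : Set (SL2 K)) ≤ F.ker := by
      rw [← hsup]
      apply sup_le
      · apply commV_le
        rintro _ ⟨a, rfl⟩ v
        rw [AddMonoidHom.mem_ker, hF, zX', neg_add_cancel]
      · apply commV_le
        rintro _ ⟨a, rfl⟩ v
        rw [AddMonoidHom.mem_ker, hF, zY', neg_add_cancel]
    intro v hv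
    have := this hv
    rw [AddMonoidHom.mem_ker, hF] at this
    exact eq_neg_of_add_eq_zero_left this
  have hUG : commV V (Set.range (uEl (K := K))) ≤ commV V (Set.univ : Set (SL2 K)) :=
    hsup ▸ le_sup_left
  have hUmG : commV V (Set.range (umEl (K := K))) ≤ commV V (Set.univ : Set (SL2 K)) :=
    hsup ▸ le_sup_right
  refine ⟨⟨?_, hsup⟩, ?_, ⟨?_, ?_⟩, hneg, fun v hv => hv _ (Set.mem_univ _)⟩
  · rw [AddSubgroup.disjoint_def]
    intro v h1 h2
    rw [← EU v h1]
    exact hE0 v (fU v h1 _) (fUm v h2 _)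
  · intro v
    refine ⟨fun hv => ⟨hUG hv, fU v hv⟩, ?_⟩
    rintro ⟨hv, hf⟩
    rw [← hsup, AddSubgroup.mem_sup] at hv
    obtain ⟨a, ha, b, hb, rfl⟩ := hv
    have hb0 : b = 0 := by
      rw [← EUm b hb]
      apply hE0 b _ (fUm b hb _)
      have := hf 1
      rw [smul_add, fU a ha] at this
      exact add_left_cancel this
    rw [hb0, add_zero]; exact ha
  · apply Set.Subset.antisymm
    · rintro _ ⟨v, hv, rfl⟩
      exact wU v hv
    · intro v hv
      refine ⟨wEl K • (-v), wUm _ (neg_mem hv), ?_⟩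
      change wEl K • wEl K • (-v) = v
      rw [hneg _ (hUmG (neg_mem hv)), neg_neg]
  · apply Set.Subset.antisymm
    · rintro _ ⟨v, hv, rfl⟩
      exact wUm v hv
    · intro v hv
      refine ⟨wEl K • (-v), wU _ (neg_mem hv), ?_⟩
      change wEl K • wEl K • (-v) = v
      rw [hneg _ (hUG (neg_mem hv)), neg_neg]
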